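/- For every x ∈ S̃_{k+1} there exists a proper subset A ⊊ I such that ℓ(x d_A^{−1}) = ℓ(x) − |A|, and such that every proper subset B ⊊ I with ℓ(x d_B^{−1}) = ℓ(x) − |B| satisfies B ⊆ A. In particular, A is the unique maximal proper subset of I such that x = y d_A with ℓ(x) = ℓ(y) + |A| for some y ∈ S̃_{k+1}. -/

import Mathlib

/-- `x : Equiv.Perm ℤ` is an affine permutation in `S̃_{k+1}`: it commutes with
translation by `k+1` and its window sums to `(k+1)(k+2)/2`. -/
def IsAffinePerm (k : ℕ) (x : Equiv.Perm ℤ) : Prop :=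
  (∀ i : ℤ, x (i + (k + 1)) = x i + (k + 1)) ∧
  ∑ i ∈ Finset.Icc (1 : ℤ) (k + 1), x i = (k + 1) * (k + 2) / 2

/-- The underlying function of the simple generator `s_i`. -/
def sAffFun (k : ℕ) (i : ZMod (k + 1)) (j : ℤ) : ℤ :=
  if (j : ZMod (k + 1)) = i then j + 1
  else if (j : ZMod (k + 1)) = i + 1 then j - 1
  else j

theorem sAffFun_invol (k : ℕ) (i : ZMod (k + 1)) (h : ¬ (1 : ZMod (k + 1)) = 0) :
    Function.Involutive (sAffFun k i) := by
  have hne : i + 1 ≠ i := fun hc => h (by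
    have h2 : i + 1 = i + 0 := by simpa using hc
    exact add_left_cancel h2)
  intro j
  by_cases h1 : (j : ZMod (k + 1)) = i
  · have e1 : sAffFun k i j = j + 1 := if_pos h1
    have hj1 : ((j + 1 : ℤ) : ZMod (k + 1)) = i + 1 := by push_cast; rw [h1]
    have e2 : sAffFun k i (j + 1) = j := by
      unfold sAffFun
      rw [if_neg (by rw [hj1]; exact hne), if_pos hj1]
      ring
    rw [e1, e2]
  · by_cases h2 : (j : ZMod (k + 1)) = i + 1
    · have e1 : sAffFun k i j = j - 1 := by unfold sAffFun; rw [if_neg h1, if_pos h2]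
      have hj1 : ((j - 1 : ℤ) : ZMod (k + 1)) = i := by push_cast; rw [h2]; ring
      have e2 : sAffFun k i (j - 1) = j := by
        unfold sAffFun; rw [if_pos hj1]; ring
      rw [e1, e2]
    · have e1 : sAffFun k i j = j := by unfold sAffFun; rw [if_neg h1, if_neg h2]
      rw [e1, e1]

/-- The simple generator `s_i` of the affine symmetric group, as a permutation of `ℤ`:
it interchanges `m(k+1) + ī` and `m(k+1) + ī + 1` for every `m` (when `k ≥ 1`). -/
noncomputable def sAff (k : ℕ) (i : ZMod (k + 1)) : Equiv.Perm ℤ :=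
  if h : (1 : ZMod (k + 1)) = 0 then 1 else Function.Involutive.toPerm _ (sAffFun_invol k i h)

/-- The Coxeter length of `x`: the least number of simple generators whose product is `x`. -/
noncomputable def affLen (k : ℕ) (x : Equiv.Perm ℤ) : ℕ :=
  sInf {n : ℕ | ∃ w : List (ZMod (k + 1)), w.length = n ∧ x = (w.map (sAff k)).prod}

/-- The right descent set `D_R(x) = {i : ℓ(x s_i) < ℓ(x)}`. -/
noncomputable def rightDescents (k : ℕ) (x : Equiv.Perm ℤ) : Set (ZMod (k + 1)) :=
  {i | affLen k (x * sAff k i) < affLen k x}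

/-- The cyclic interval `[i,j] = {i, i+1, …, j}` of residues mod `k+1`. -/
def cycInt (k : ℕ) (i j : ZMod (k + 1)) : Finset (ZMod (k + 1)) :=
  (Finset.range ((j - i).val + 1)).image fun t : ℕ => i + (t : ZMod (k + 1))

/-- A choice of a "gate" residue not belonging to `A` (when `A` is proper). -/
noncomputable def gate (k : ℕ) (A : Finset (ZMod (k + 1))) : ZMod (k + 1) :=
  if h : ∃ g, g ∉ A then h.choose else 0

/-- The cyclically decreasing element `d_A`: the product of the `s_a`, `a ∈ A`, in an
order where `s_{a+1}` occurs to the left of `s_a` whenever `a, a+1 ∈ A`. -/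
noncomputable def dElt (k : ℕ) (A : Finset (ZMod (k + 1))) : Equiv.Perm ℤ :=
  (((((List.range (k + 1)).reverse.map fun t : ℕ => gate k A + (t : ZMod (k + 1))).filter
      fun a => decide (a ∈ A)).map (sAff k)).prod)

/-- The cyclically increasing element `u_A`: the product of the `s_a`, `a ∈ A`, in an
order where `s_{a+1}` occurs to the right of `s_a` whenever `a, a+1 ∈ A`. -/
noncomputable def uElt (k : ℕ) (A : Finset (ZMod (k + 1))) : Equiv.Perm ℤ :=
  ((((List.range (k + 1)).map fun t : ℕ => gate k A + (t : ZMod (k + 1))).filter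
      fun a => decide (a ∈ A)).map (sAff k)).prod

/-- The right decreasing code: `CRD(x)_i = #{j < ī : x(j) > x(ī)}`. -/
noncomputable def CRD (k : ℕ) (x : Equiv.Perm ℤ) (i : ZMod (k + 1)) : ℕ :=
  Set.ncard {j : ℤ | j < (i.val : ℤ) ∧ x (i.val : ℤ) < x j}

/-- The right increasing code: `CRI(x)_i = #{j > ī + 1 : x(j) < x(ī + 1)}`. -/
noncomputable def CRI (k : ℕ) (x : Equiv.Perm ℤ) (i : ZMod (k + 1)) : ℕ :=
  Set.ncard {j : ℤ | (i.val : ℤ) + 1 < j ∧ x j < x ((i.val : ℤ) + 1)}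

/-- The left decreasing code: `CLD(x)_i = #{j < x⁻¹(ī + 1) : x(j) > ī + 1}`. -/
noncomputable def CLD (k : ℕ) (x : Equiv.Perm ℤ) (i : ZMod (k + 1)) : ℕ :=
  Set.ncard {j : ℤ | j < x.symm ((i.val : ℤ) + 1) ∧ (i.val : ℤ) + 1 < x j}

/-- The left increasing code: `CLI(x)_i = #{j > x⁻¹(ī) : x(j) < ī}`. -/
noncomputable def CLI (k : ℕ) (x : Equiv.Perm ℤ) (i : ZMod (k + 1)) : ℕ :=
  Set.ncard {j : ℤ | x.symm ((i.val : ℤ)) < j ∧ x j < (i.val : ℤ)}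

/-- Equivariance of a permutation of `ℤ` under translation by `k + 1`. -/
def IsShiftEquivariant (k : ℕ) (x : Equiv.Perm ℤ) : Prop :=
  ∀ i : ℤ, x (i + (k + 1)) = x i + (k + 1)

/-- The number of inversions of `x` whose left end is `i`. -/
noncomputable def invAt (x : Equiv.Perm ℤ) (i : ℤ) : ℕ :=
  Set.ncard {j : ℤ | i < j ∧ x j < x i}

/-- The number of inversions of `x` up to translation by `k + 1`. -/
noncomputable def invCount (k : ℕ) (x : Equiv.Perm ℤ) : ℕ :=
  ∑ r : ZMod (k + 1), invAt x (r.val : ℤ)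

/-- The total displacement of `x` over a period. -/
noncomputable def totalShift (k : ℕ) (x : Equiv.Perm ℤ) : ℤ :=
  ∑ r : ZMod (k + 1), (x (r.val : ℤ) - (r.val : ℤ))

theorem eq_val_of_periodic {k : ℕ} {M : Type*} {f : ℤ → M}
    (hf : ∀ i, f (i + (k + 1)) = f i) (i : ℤ) :
    f (((i : ZMod (k + 1)).val : ℕ) : ℤ) = f i := by
  have hp : Function.Periodic f ((k : ℤ) + 1) := hf
  have h : ((((i : ZMod (k + 1)).val : ℕ) : ℤ)) = i - (i / (k + 1)) * (k + 1) := by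
    rw [ZMod.val_intCast]
    push_cast
    rw [Int.emod_def]
    ring
  rw [h]
  exact hp.sub_int_mul_eq _

theorem intCast_eq_iff_dvd {k : ℕ} {a b : ℤ} :
    (a : ZMod (k + 1)) = b ↔ ((k : ℤ) + 1) ∣ b - a := by
  rw [ZMod.intCast_eq_intCast_iff_dvd_sub]
  push_cast
  rfl

theorem one_ne_zero_of_le {k : ℕ} (hk : 1 ≤ k) : ¬ (1 : ZMod (k + 1)) = 0 := by
  have : Fact (1 < k + 1) := ⟨by omega⟩
  exact one_ne_zero

theorem sAff_apply {k : ℕ} (hk : 1 ≤ k) (i : ZMod (k + 1)) (j : ℤ) :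
    sAff k i j = sAffFun k i j := by
  rw [sAff, dif_neg (one_ne_zero_of_le hk)]
  rfl

theorem sAff_mul_self {k : ℕ} (hk : 1 ≤ k) (i : ZMod (k + 1)) : sAff k i * sAff k i = 1 := by
  ext j
  rw [Equiv.Perm.mul_apply, sAff_apply hk, sAff_apply hk]
  exact sAffFun_invol k i (one_ne_zero_of_le hk) j

theorem sAff_apply_left {k : ℕ} (hk : 1 ≤ k) (p : ℤ) : sAff k (p : ZMod (k + 1)) p = p + 1 := by
  rw [sAff_apply hk, sAffFun, if_pos rfl]

theorem sAff_apply_right {k : ℕ} (hk : 1 ≤ k) (p : ℤ) :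
    sAff k (p : ZMod (k + 1)) (p + 1) = p := by
  rw [← sAff_apply_left hk p, ← Equiv.Perm.mul_apply, sAff_mul_self hk, Equiv.Perm.one_apply]

theorem sAff_apply_of_ne {k : ℕ} (hk : 1 ≤ k) {i : ZMod (k + 1)} {j : ℤ}
    (h1 : (j : ZMod (k + 1)) ≠ i) (h2 : (j : ZMod (k + 1)) ≠ i + 1) : sAff k i j = j := by
  rw [sAff_apply hk, sAffFun, if_neg h1, if_neg h2]

theorem IsShiftEquivariant.mul {k : ℕ} {x y : Equiv.Perm ℤ} (hx : IsShiftEquivariant k x)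
    (hy : IsShiftEquivariant k y) : IsShiftEquivariant k (x * y) := fun i => by
  rw [Equiv.Perm.mul_apply, hy, hx, Equiv.Perm.mul_apply]

theorem isShiftEquivariant_sAff {k : ℕ} (hk : 1 ≤ k) (i : ZMod (k + 1)) :
    IsShiftEquivariant k (sAff k i) := fun j => by
  have h : ((j + (k + 1) : ℤ) : ZMod (k + 1)) = j := by
    rw [intCast_eq_iff_dvd]
    exact ⟨-1, by ring⟩
  rw [sAff_apply hk, sAff_apply hk, sAffFun, sAffFun, h]
  split_ifs <;> ring

theorem IsShiftEquivariant.exists_bound {k : ℕ} {x : Equiv.Perm ℤ}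
    (hx : IsShiftEquivariant k x) : ∃ C : ℤ, ∀ i, |x i - i| ≤ C := by
  refine ⟨∑ r : ZMod (k + 1), |x (r.val : ℤ) - (r.val : ℤ)|, fun i => ?_⟩
  have h := eq_val_of_periodic (k := k) (f := fun i => |x i - i|)
    (fun i => by simp only [hx i]; congr 1; ring) i
  rw [← h]
  exact Finset.single_le_sum (f := fun r : ZMod (k + 1) => |x (r.val : ℤ) - (r.val : ℤ)|)
    (fun _ _ => abs_nonneg _) (Finset.mem_univ _)

theorem IsShiftEquivariant.finite_gt_lt {k : ℕ} {x : Equiv.Perm ℤ}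
    (hx : IsShiftEquivariant k x) (i v : ℤ) : {j : ℤ | i < j ∧ x j < v}.Finite := by
  obtain ⟨C, hC⟩ := hx.exists_bound
  refine (Set.finite_Ioo i (v + C)).subset fun j hj => ⟨hj.1, ?_⟩
  have := (abs_le.1 (hC j)).1
  have := hj.2
  linarith

theorem IsShiftEquivariant.invAt_add {k : ℕ} {x : Equiv.Perm ℤ}
    (hx : IsShiftEquivariant k x) (i : ℤ) : invAt x (i + (k + 1)) = invAt x i := by
  unfold invAt
  symm
  refine Set.ncard_congr (fun j _ => j + (k + 1)) ?_ ?_ ?_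
  · rintro j ⟨h1, h2⟩
    exact ⟨by linarith, by rw [hx, hx]; linarith⟩
  · intro a b _ _ h
    simpa using h
  · rintro j ⟨h1, h2⟩
    refine ⟨j - (k + 1), ⟨by linarith, ?_⟩, by ring⟩
    have h := hx (j - (k + 1))
    rw [sub_add_cancel] at h
    rw [hx] at h2
    linarith

theorem invAt_mul_sAff_of_ne {k : ℕ} (hk : 1 ≤ k) (x : Equiv.Perm ℤ) {p : ZMod (k + 1)} {i : ℤ}
    (h1 : (i : ZMod (k + 1)) ≠ p) (h2 : (i : ZMod (k + 1)) ≠ p + 1) :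
    invAt (x * sAff k p) i = invAt x i := by
  have key : ∀ j : ℤ, i < j → i < sAff k p j := by
    intro j hj
    rw [sAff_apply hk, sAffFun]
    split_ifs with h3 h4
    · linarith
    · rcases (show i ≤ j - 1 by omega).lt_or_eq with h | h
      · exact h
      · exact absurd (by rw [h]; push_cast; rw [h4]; ring) h1
    · exact hj
  have hinv : ∀ j : ℤ, sAff k p (sAff k p j) = j := fun j => by
    rw [← Equiv.Perm.mul_apply, sAff_mul_self hk, Equiv.Perm.one_apply]
  unfold invAt
  refine Set.ncard_congr (fun j _ => sAff k p j) ?_ ?_ ?_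
  · rintro j ⟨h3, h4⟩
    rw [Equiv.Perm.mul_apply, Equiv.Perm.mul_apply, sAff_apply_of_ne hk h1 h2] at h4
    exact ⟨key j h3, h4⟩
  · intro a b _ _ h
    exact (sAff k p).injective h
  · rintro j ⟨h3, h4⟩
    refine ⟨sAff k p j, ⟨key j h3, ?_⟩, hinv j⟩
    rw [Equiv.Perm.mul_apply, Equiv.Perm.mul_apply, sAff_apply_of_ne hk h1 h2, hinv]
    exact h4

theorem sAff_gt_iff {k : ℕ} (hk : 1 ≤ k) (p j : ℤ) :
    p + 1 < sAff k (p : ZMod (k + 1)) j ↔ p + 1 < j := by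
  have key : ∀ j : ℤ, p + 1 < j → p + 1 < sAff k (p : ZMod (k + 1)) j := by
    intro j hj
    rw [sAff_apply hk, sAffFun]
    split_ifs with h3 h4
    · linarith
    · rcases (show p + 2 ≤ j by omega).lt_or_eq with h | h
      · linarith
      · exfalso
        refine one_ne_zero_of_le hk ?_
        rw [← h] at h4
        push_cast at h4
        have h5 : (1 : ZMod (k + 1)) = (p + 2 : ZMod (k + 1)) - (p + 1) := by ring
        rw [h5, h4, sub_self]
    · exact hj
  refine ⟨fun h => ?_, key j⟩
  have := key _ h
  rwa [← Equiv.Perm.mul_apply, sAff_mul_self hk, Equiv.Perm.one_apply] at this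

/-- The number of `j > p + 1` with `x j < v` is unchanged by right multiplication by `s_p`. -/
theorem ncard_gt_mul_sAff {k : ℕ} (hk : 1 ≤ k) (x : Equiv.Perm ℤ) (p v : ℤ) :
    Set.ncard {j : ℤ | p + 1 < j ∧ (x * sAff k (p : ZMod (k + 1))) j < v} =
      Set.ncard {j : ℤ | p + 1 < j ∧ x j < v} := by
  have hinv : ∀ j : ℤ, sAff k (p : ZMod (k + 1)) (sAff k p j) = j := fun j => by
    rw [← Equiv.Perm.mul_apply, sAff_mul_self hk, Equiv.Perm.one_apply]
  refine Set.ncard_congr (fun j _ => sAff k (p : ZMod (k + 1)) j) ?_ ?_ ?_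
  · rintro j ⟨h3, h4⟩
    exact ⟨(sAff_gt_iff hk p j).2 h3, h4⟩
  · intro a b _ _ h
    exact (sAff k (p : ZMod (k + 1))).injective h
  · rintro j ⟨h3, h4⟩
    refine ⟨sAff k (p : ZMod (k + 1)) j, ⟨(sAff_gt_iff hk p j).2 h3, ?_⟩, hinv j⟩
    rw [Equiv.Perm.mul_apply, hinv]
    exact h4

theorem IsShiftEquivariant.invAt_eq {k : ℕ} {x : Equiv.Perm ℤ} (hx : IsShiftEquivariant k x)
    (p : ℤ) : invAt x p =
      Set.ncard {j : ℤ | p + 1 < j ∧ x j < x p} + if x (p + 1) < x p then 1 else 0 := by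
  unfold invAt
  split_ifs with h
  · rw [← Set.ncard_insert_of_notMem (a := p + 1) (by simp) (hx.finite_gt_lt _ _)]
    congr 1
    ext j
    simp only [Set.mem_ofPred_eq, Set.mem_insert_iff]
    constructor
    · rintro ⟨h1, h2⟩
      by_cases hj : j = p + 1
      · exact Or.inl hj
      · exact Or.inr ⟨by omega, h2⟩
    · rintro (rfl | ⟨h1, h2⟩)
      · exact ⟨by omega, h⟩
      · exact ⟨by omega, h2⟩
  · rw [add_zero]
    congr 1
    ext j
    simp only [Set.mem_ofPred_eq]
    refine ⟨fun ⟨h1, h2⟩ => ⟨?_, h2⟩, fun ⟨h1, h2⟩ => ⟨by omega, h2⟩⟩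
    have : j ≠ p + 1 := by
      rintro rfl
      exact h h2
    omega

/-- Split the terms at `p` and `p + 1` off a sum over `ZMod (k + 1)`. -/
theorem sum_zmod_eq_pair_add_sum_erase {k : ℕ} (hk : 1 ≤ k) {M : Type*} [AddCommMonoid M]
    (f : ZMod (k + 1) → M) (p : ZMod (k + 1)) :
    ∑ r, f r = (f p + f (p + 1)) + ∑ r ∈ (Finset.univ.erase p).erase (p + 1), f r := by
  have hne : p + 1 ≠ p := fun h => one_ne_zero_of_le hk (by simpa using h)
  rw [← Finset.add_sum_erase _ _ (Finset.mem_univ p),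
    ← Finset.add_sum_erase _ _ (Finset.mem_erase.2 ⟨hne, Finset.mem_univ (p + 1)⟩), add_assoc]

theorem IsShiftEquivariant.invCount_mul_sAff {k : ℕ} (hk : 1 ≤ k) {x : Equiv.Perm ℤ}
    (hx : IsShiftEquivariant k x) (p : ℤ) :
    invCount k (x * sAff k p) + (if x (p + 1) < x p then 1 else 0) =
      invCount k x + if x p < x (p + 1) then 1 else 0 := by
  have hy := hx.mul (isShiftEquivariant_sAff hk (p : ZMod (k + 1)))
  set y := x * sAff k (p : ZMod (k + 1)) with hydef
  have yp : y p = x (p + 1) := by rw [hydef, Equiv.Perm.mul_apply, sAff_apply_left hk]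
  have yp1 : y (p + 1) = x p := by rw [hydef, Equiv.Perm.mul_apply, sAff_apply_right hk]
  have e1 := hx.invAt_eq p
  have e2 := hy.invAt_eq p
  rw [yp, yp1, hydef, ncard_gt_mul_sAff hk, ← hydef] at e2
  have e3 : invAt y (p + 1) = Set.ncard {j : ℤ | p + 1 < j ∧ x j < x p} := by
    rw [invAt, yp1, hydef, ncard_gt_mul_sAff hk]
  have e4 : invAt x (p + 1) = Set.ncard {j : ℤ | p + 1 < j ∧ x j < x (p + 1)} := rfl
  have v : ∀ {z : Equiv.Perm ℤ}, IsShiftEquivariant k z → ∀ i : ℤ,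
      invAt z ((i : ZMod (k + 1)).val : ℤ) = invAt z i := fun hz i =>
    eq_val_of_periodic hz.invAt_add i
  have hrest : ∑ r ∈ (Finset.univ.erase (p : ZMod (k + 1))).erase ((p : ZMod (k + 1)) + 1),
      invAt y (r.val : ℤ) =
      ∑ r ∈ (Finset.univ.erase (p : ZMod (k + 1))).erase ((p : ZMod (k + 1)) + 1),
      invAt x (r.val : ℤ) := by
    refine Finset.sum_congr rfl fun r hr => ?_
    simp only [Finset.mem_erase] at hr
    exact invAt_mul_sAff_of_ne hk x (by simpa using hr.2.1) (by simpa using hr.1)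
  have v1 : ∀ {z : Equiv.Perm ℤ}, IsShiftEquivariant k z →
      invAt z (((p : ZMod (k + 1)) + 1).val : ℤ) = invAt z (p + 1) := fun hz => by
    simpa using v hz (p + 1)
  rw [invCount, invCount, sum_zmod_eq_pair_add_sum_erase hk _ (p : ZMod (k + 1)),
    sum_zmod_eq_pair_add_sum_erase hk (fun r : ZMod (k + 1) => invAt x (r.val : ℤ))
      (p : ZMod (k + 1)), hrest, v hx, v hy, v1 hx, v1 hy]
  omega

theorem IsShiftEquivariant.invCount_mul_sAff_of_gt {k : ℕ} (hk : 1 ≤ k) {x : Equiv.Perm ℤ}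
    (hx : IsShiftEquivariant k x) {p : ℤ} (h : x (p + 1) < x p) :
    invCount k (x * sAff k p) + 1 = invCount k x := by
  simpa [h, h.not_gt] using hx.invCount_mul_sAff hk p

theorem IsShiftEquivariant.totalShift_mul_sAff {k : ℕ} (hk : 1 ≤ k) {x : Equiv.Perm ℤ}
    (hx : IsShiftEquivariant k x) (p : ZMod (k + 1)) :
    totalShift k (x * sAff k p) = totalShift k x := by
  obtain ⟨p, rfl⟩ := ZMod.intCast_surjective p
  have v : ∀ {z : Equiv.Perm ℤ}, IsShiftEquivariant k z → ∀ i : ℤ,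
      z ((i : ZMod (k + 1)).val : ℤ) - ((i : ZMod (k + 1)).val : ℤ) = z i - i := fun hz i =>
    eq_val_of_periodic (f := fun i => _ - i) (fun i => by rw [hz]; ring) i
  have v1 : ∀ {z : Equiv.Perm ℤ}, IsShiftEquivariant k z →
      z (((p : ZMod (k + 1)) + 1).val : ℤ) - (((p : ZMod (k + 1)) + 1).val : ℤ) =
        z (p + 1) - (p + 1) := fun hz => by
    have := v hz (p + 1)
    push_cast at this
    exact this
  have hy := hx.mul (isShiftEquivariant_sAff hk (p : ZMod (k + 1)))
  have hrest : ∑ r ∈ (Finset.univ.erase (p : ZMod (k + 1))).erase ((p : ZMod (k + 1)) + 1),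
      ((x * sAff k (p : ZMod (k + 1))) (r.val : ℤ) - (r.val : ℤ)) =
      ∑ r ∈ (Finset.univ.erase (p : ZMod (k + 1))).erase ((p : ZMod (k + 1)) + 1),
      (x (r.val : ℤ) - (r.val : ℤ)) := by
    refine Finset.sum_congr rfl fun r hr => ?_
    simp only [Finset.mem_erase] at hr
    rw [Equiv.Perm.mul_apply,
      sAff_apply_of_ne hk (by simpa using hr.2.1) (by simpa using hr.1)]
  rw [totalShift, totalShift, sum_zmod_eq_pair_add_sum_erase hk _ (p : ZMod (k + 1)),
    sum_zmod_eq_pair_add_sum_erase hk (fun r : ZMod (k + 1) => x (r.val : ℤ) - (r.val : ℤ))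
      (p : ZMod (k + 1)), hrest, v hx, v hy, v1 hx, v1 hy,
    Equiv.Perm.mul_apply, Equiv.Perm.mul_apply, sAff_apply_left hk, sAff_apply_right hk]
  ring

theorem IsAffinePerm.totalShift_eq_zero {k : ℕ} {x : Equiv.Perm ℤ} (hx : IsAffinePerm k x) :
    totalShift k x = 0 := by
  have hS : IsShiftEquivariant k x := hx.1
  have hsum : ∀ m : ℕ, ∑ i ∈ Finset.Icc (1 : ℤ) m, i = m * (m + 1) / 2 := by
    intro m
    have h2 : (∑ i ∈ Finset.Icc (1 : ℤ) m, i) * 2 = m * (m + 1) := by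
      induction m with
      | zero => simp
      | succ m ih =>
        have : Finset.Icc (1 : ℤ) ((m + 1 : ℕ) : ℤ) =
            insert ((m : ℤ) + 1) (Finset.Icc (1 : ℤ) m) := by
          ext j
          simp only [Finset.mem_Icc, Finset.mem_insert]
          push_cast
          omega
        rw [this, Finset.sum_insert (by simp), add_mul, ih]
        push_cast
        ring
    omega
  have h1 : totalShift k x = ∑ i ∈ Finset.Icc (1 : ℤ) (k + 1), (x i - i) := by
    symm
    rw [totalShift]
    refine Finset.sum_bij (fun i _ => (i : ZMod (k + 1))) (fun _ _ => Finset.mem_univ _) ?_ ?_ ?_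
    · intro a ha b hb hab
      rw [Finset.mem_Icc] at ha hb
      obtain ⟨c, hc⟩ := intCast_eq_iff_dvd.1 hab
      have hc0 : c = 0 := by
        by_contra h
        rcases lt_or_gt_of_ne h with h | h <;> nlinarith
      rw [hc0] at hc
      linarith
    · intro r _
      have hr := ZMod.val_lt r
      by_cases h0 : r.val = 0
      · refine ⟨(k : ℤ) + 1, by simp, ?_⟩
        rw [(ZMod.val_eq_zero r).1 h0]
        have := ZMod.natCast_self (k + 1)
        push_cast at this ⊢
        exact this
      · exact ⟨r.val, Finset.mem_Icc.2 ⟨by omega, by omega⟩, by simp⟩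
    · intro i _
      exact (eq_val_of_periodic (f := fun i => x i - i) (fun i => by rw [hS]; ring) i).symm
  rw [h1, Finset.sum_sub_distrib, hx.2]
  have := hsum (k + 1)
  push_cast at this
  rw [this]
  ring_nf

/-- An increasing permutation of `ℤ` with zero total displacement is the identity. -/
theorem eq_one_of_lt_succ {k : ℕ} {x : Equiv.Perm ℤ}
    (h0 : totalShift k x = 0) (hlt : ∀ p : ℤ, x p < x (p + 1)) : x = 1 := by
  have hmono : StrictMono x := strictMono_int_of_lt_succ hlt
  have hsucc : ∀ p : ℤ, x (p + 1) = x p + 1 := by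
    intro p
    obtain ⟨j, hj⟩ := x.surjective (x p + 1)
    have h1 : p < j := hmono.lt_iff_lt.1 (by omega)
    have h2 : x (p + 1) ≤ x j := hmono.monotone (by omega)
    have := hlt p
    omega
  have hshift : ∀ p : ℤ, x p = p + x 0 := by
    intro p
    induction p using Int.induction_on with
    | zero => simp
    | succ i ih => rw [hsucc, ih]; ring
    | pred i ih =>
      have := hsucc (-(i : ℤ) - 1)
      rw [sub_add_cancel, ih] at this
      linarith
  have hx0 : x 0 = 0 := by
    rw [totalShift, Finset.sum_congr rfl (g := fun _ => x 0)
      (fun r _ => by rw [hshift]; ring)] at h0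
    simp only [Finset.sum_const, Finset.card_univ, ZMod.card, nsmul_eq_mul] at h0
    rcases mul_eq_zero.1 h0 with h | h
    · exact absurd h (by positivity)
    · exact h
  ext p
  rw [hshift, hx0, add_zero, Equiv.Perm.one_apply]

theorem isShiftEquivariant_prod {k : ℕ} (hk : 1 ≤ k) (w : List (ZMod (k + 1))) :
    IsShiftEquivariant k (w.map (sAff k)).prod := by
  induction w with
  | nil => exact fun i => rfl
  | cons a w ih =>
    rw [List.map_cons, List.prod_cons]
    exact (isShiftEquivariant_sAff hk a).mul ih

theorem IsShiftEquivariant.invCount_mul_sAff_le {k : ℕ} (hk : 1 ≤ k) {x : Equiv.Perm ℤ}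
    (hx : IsShiftEquivariant k x) (p : ZMod (k + 1)) :
    invCount k (x * sAff k p) ≤ invCount k x + 1 := by
  obtain ⟨p, rfl⟩ := ZMod.intCast_surjective p
  have := hx.invCount_mul_sAff hk p
  split_ifs at this <;> omega

theorem invCount_one (k : ℕ) : invCount k 1 = 0 := by
  refine Finset.sum_eq_zero fun r _ => ?_
  rw [invAt]
  convert Set.ncard_empty ℤ
  ext j
  simp only [Equiv.Perm.one_apply, Set.mem_ofPred_eq, Set.mem_empty_iff_false, iff_false]
  omega

theorem invCount_prod_le {k : ℕ} (hk : 1 ≤ k) (w : List (ZMod (k + 1))) :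
    invCount k (w.map (sAff k)).prod ≤ w.length := by
  induction w using List.reverseRecOn with
  | nil => simp [invCount_one]
  | append_singleton w a ih =>
    rw [List.map_append, List.prod_append, List.length_append]
    simpa using ((isShiftEquivariant_prod hk w).invCount_mul_sAff_le hk a).trans
      (Nat.add_le_add_right ih 1)

theorem exists_word_of_totalShift_eq_zero {k : ℕ} (hk : 1 ≤ k) (m : ℕ) :
    ∀ x : Equiv.Perm ℤ, IsShiftEquivariant k x → totalShift k x = 0 → invCount k x = m →
      ∃ w : List (ZMod (k + 1)), w.length = m ∧ x = (w.map (sAff k)).prod := by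
  induction m with
  | zero =>
    intro x hx h0 hm
    refine ⟨[], rfl, ?_⟩
    rw [List.map_nil, List.prod_nil]
    refine eq_one_of_lt_succ h0 fun p => ?_
    by_contra h
    have hne : x (p + 1) ≠ x p := fun h => by simpa using x.injective h
    have := hx.invCount_mul_sAff_of_gt hk (lt_of_le_of_ne (not_lt.1 h) hne)
    omega
  | succ m ih =>
    intro x hx h0 hm
    obtain ⟨p, hp⟩ : ∃ p : ℤ, x (p + 1) < x p := by
      by_contra! h
      have hlt : ∀ p : ℤ, x p < x (p + 1) := fun p =>
        lt_of_le_of_ne (h p) fun h => by simpa using x.injective h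
      rw [eq_one_of_lt_succ h0 hlt, invCount_one] at hm
      omega
    obtain ⟨w, hw, hxw⟩ := ih (x * sAff k p) (hx.mul (isShiftEquivariant_sAff hk _))
      ((hx.totalShift_mul_sAff hk _).trans h0)
      (by have := hx.invCount_mul_sAff_of_gt hk hp; omega)
    refine ⟨w ++ [(p : ZMod (k + 1))], by simp [hw], ?_⟩
    rw [List.map_append, List.prod_append, ← hxw]
    simp [mul_assoc, sAff_mul_self hk]

theorem IsShiftEquivariant.affLen_eq_invCount {k : ℕ} (hk : 1 ≤ k) {x : Equiv.Perm ℤ}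
    (hx : IsShiftEquivariant k x) (h0 : totalShift k x = 0) : affLen k x = invCount k x := by
  obtain ⟨w, hw⟩ := exists_word_of_totalShift_eq_zero hk _ x hx h0 rfl
  refine le_antisymm (Nat.sInf_le ⟨w, hw⟩) ?_
  obtain ⟨w', h1, h2⟩ := Nat.sInf_mem
    (s := {n : ℕ | ∃ w : List (ZMod (k + 1)), w.length = n ∧ x = (w.map (sAff k)).prod})
    ⟨_, w, hw⟩
  rw [affLen, ← h1]
  calc invCount k x = invCount k (w'.map (sAff k)).prod := by rw [← h2]
    _ ≤ _ := invCount_prod_le hk w'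

/-- The partial product of `x` with `s_g, s_{g+1}, …` over the elements of `B` among the first `t`
residues starting at `g`. -/
noncomputable def partialMul (k : ℕ) (B : Finset (ZMod (k + 1))) (g : ℤ) (x : Equiv.Perm ℤ) :
    ℕ → Equiv.Perm ℤ
  | 0 => x
  | t + 1 => if ((g + t : ℤ) : ZMod (k + 1)) ∈ B then
      partialMul k B g x t * sAff k ((g + t : ℤ) : ZMod (k + 1)) else partialMul k B g x t

theorem isShiftEquivariant_partialMul {k : ℕ} (hk : 1 ≤ k) (B : Finset (ZMod (k + 1))) (g : ℤ)
    {x : Equiv.Perm ℤ} (hx : IsShiftEquivariant k x) (t : ℕ) :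
    IsShiftEquivariant k (partialMul k B g x t) := by
  induction t with
  | zero => exact hx
  | succ t ih =>
    rw [partialMul]
    split_ifs
    · exact ih.mul (isShiftEquivariant_sAff hk _)
    · exact ih

theorem totalShift_partialMul {k : ℕ} (hk : 1 ≤ k) (B : Finset (ZMod (k + 1))) (g : ℤ)
    {x : Equiv.Perm ℤ} (hx : IsShiftEquivariant k x) (t : ℕ) :
    totalShift k (partialMul k B g x t) = totalShift k x := by
  induction t with
  | zero => rfl
  | succ t ih =>
    rw [partialMul]
    split_ifs
    · rw [(isShiftEquivariant_partialMul hk B g hx t).totalShift_mul_sAff hk, ih]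
    · exact ih

/-- The number of elements of `B` among the first `t` residues starting at `g`. -/
def partialCard (k : ℕ) (B : Finset (ZMod (k + 1))) (g : ℤ) (t : ℕ) : ℕ :=
  ((Finset.range t).filter fun s : ℕ => ((g + s : ℤ) : ZMod (k + 1)) ∈ B).card

theorem partialCard_succ (k : ℕ) (B : Finset (ZMod (k + 1))) (g : ℤ) (t : ℕ) :
    partialCard k B g (t + 1) =
      partialCard k B g t + if ((g + t : ℤ) : ZMod (k + 1)) ∈ B then 1 else 0 := by
  rw [partialCard, partialCard, Finset.range_add_one, Finset.filter_insert]
  split_ifs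
  · rw [Finset.card_insert_of_notMem (by simp)]
  · rfl

theorem partialCard_period (k : ℕ) (B : Finset (ZMod (k + 1))) (g : ℤ) :
    partialCard k B g (k + 1) = B.card := by
  refine Finset.card_bij (fun s _ => ((g + s : ℤ) : ZMod (k + 1)))
    (fun s hs => (Finset.mem_filter.1 hs).2) ?_ ?_
  · intro a ha b hb hab
    have ha := Finset.mem_range.1 (Finset.mem_filter.1 ha).1
    have hb := Finset.mem_range.1 (Finset.mem_filter.1 hb).1
    push_cast at hab
    have h := congrArg ZMod.val (add_left_cancel hab)
    rwa [ZMod.val_natCast_of_lt ha, ZMod.val_natCast_of_lt hb] at h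
  · intro b hb
    have h : ((g + ((b - (g : ZMod (k + 1))).val : ℕ) : ℤ) : ZMod (k + 1)) = b := by
      push_cast
      rw [ZMod.natCast_zmod_val]
      ring
    exact ⟨(b - (g : ZMod (k + 1))).val,
      Finset.mem_filter.2 ⟨Finset.mem_range.2 (ZMod.val_lt _), by rwa [h]⟩, h⟩

/-- Right multiplication by `d_B⁻¹` applies the generators in increasing order. -/
theorem mul_dElt_inv {k : ℕ} (hk : 1 ≤ k) (B : Finset (ZMod (k + 1))) (x : Equiv.Perm ℤ) :
    x * (dElt k B)⁻¹ = partialMul k B (gate k B).val x (k + 1) := by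
  have hinv : ∀ i : ZMod (k + 1), (sAff k i)⁻¹ = sAff k i := fun i =>
    inv_eq_of_mul_eq_one_left (sAff_mul_self hk i)
  have h : ∀ t : ℕ, x * ((((List.range t).reverse.map fun t : ℕ =>
      gate k B + (t : ZMod (k + 1))).filter fun a => decide (a ∈ B)).map (sAff k)).prod⁻¹ =
      partialMul k B (gate k B).val x t := by
    intro t
    induction t with
    | zero => simp [partialMul]
    | succ t ih =>
      rw [List.range_succ, partialMul, ← ih]
      by_cases hb : gate k B + (t : ZMod (k + 1)) ∈ B <;> simp [hb, hinv, mul_assoc]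
  exact h (k + 1)

/-- Entries of the partial product not yet reached are those of `x`. -/
theorem partialMul_apply_of_lt {k : ℕ} (hk : 1 ≤ k) {B : Finset (ZMod (k + 1))} {g : ℤ}
    (hg : (g : ZMod (k + 1)) ∉ B) (x : Equiv.Perm ℤ) {t u : ℕ} (htu : t < u) (hu : u ≤ k + 1) :
    partialMul k B g x t (g + u) = x (g + u) := by
  induction t with
  | zero => rfl
  | succ t ih =>
    rw [partialMul]
    split_ifs with hb
    · have ht : t ≠ 0 := by
        rintro rfl
        exact hg (by simpa using hb)
      have hnd : ∀ d : ℤ, 0 < d → d < k + 1 → ¬ ((k : ℤ) + 1) ∣ d := fun d h1 h2 h3 =>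
        (Int.le_of_dvd h1 h3).not_gt h2
      rw [Equiv.Perm.mul_apply, sAff_apply_of_ne hk, ih (by omega)]
      · intro h
        refine hnd _ ?_ ?_ (intCast_eq_iff_dvd.1 h.symm) <;> omega
      · intro h
        rw [← Int.cast_one (R := ZMod (k + 1)), ← Int.cast_add] at h
        refine hnd _ ?_ ?_ (intCast_eq_iff_dvd.1 h.symm) <;> omega
    · exact ih (by omega)

theorem partialMul_succ_apply {k : ℕ} (hk : 1 ≤ k) {B : Finset (ZMod (k + 1))} {g : ℤ}
    (hg : (g : ZMod (k + 1)) ∉ B) (x : Equiv.Perm ℤ) {t : ℕ} (ht : t < k + 1) :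
    partialMul k B g x (t + 1) (g + t + 1) =
      if ((g + t : ℤ) : ZMod (k + 1)) ∈ B then partialMul k B g x t (g + t)
      else x (g + t + 1) := by
  rw [partialMul]
  split_ifs
  · rw [Equiv.Perm.mul_apply, sAff_apply_right hk]
  · have := partialMul_apply_of_lt hk hg x (Nat.lt_succ_self t) ht
    push_cast at this
    rwa [← add_assoc] at this

theorem partialMul_apply_succ {k : ℕ} (hk : 1 ≤ k) {B : Finset (ZMod (k + 1))} {g : ℤ}
    (hg : (g : ZMod (k + 1)) ∉ B) (x : Equiv.Perm ℤ) {t : ℕ} (ht : t < k + 1) :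
    partialMul k B g x t (g + t + 1) = x (g + t + 1) := by
  have := partialMul_apply_of_lt hk hg x (Nat.lt_succ_self t) ht
  push_cast at this
  rwa [← add_assoc] at this

theorem exists_partialMul_apply_eq {k : ℕ} (hk : 1 ≤ k) {B : Finset (ZMod (k + 1))} {g : ℤ}
    (hg : (g : ZMod (k + 1)) ∉ B) (x : Equiv.Perm ℤ) {t : ℕ} (ht : t ≤ k + 1) :
    ∃ m ≤ g + t, partialMul k B g x t (g + t) = x m := by
  induction t with
  | zero => exact ⟨g, by simp, by simp [partialMul]⟩
  | succ t ih =>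
    obtain ⟨m, hm, h⟩ := ih (by omega)
    push_cast
    rw [← add_assoc, partialMul_succ_apply hk hg x ht]
    split_ifs
    · exact ⟨m, by omega, h⟩
    · exact ⟨_, le_rfl, rfl⟩

theorem invCount_partialMul_mono {k : ℕ} (hk : 1 ≤ k) (B : Finset (ZMod (k + 1))) (g : ℤ)
    {x : Equiv.Perm ℤ} (hx : IsShiftEquivariant k x) :
    Monotone fun t => invCount k (partialMul k B g x t) + partialCard k B g t := by
  refine monotone_nat_of_le_succ fun t => ?_
  simp only [partialMul, partialCard_succ]
  split_ifs
  · have := (isShiftEquivariant_partialMul hk B g hx t).invCount_mul_sAff hk (g + t)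
    split_ifs at this <;> omega
  · simp

/-- The length drops by `|B|` exactly when every step is a descent. -/
theorem affLen_mul_dElt_inv_iff {k : ℕ} (hk : 1 ≤ k) {x : Equiv.Perm ℤ}
    (hx : IsShiftEquivariant k x) (h0 : totalShift k x = 0) {B : Finset (ZMod (k + 1))}
    (hg : gate k B ∉ B) :
    affLen k (x * (dElt k B)⁻¹) + B.card = affLen k x ↔
      ∀ t < k + 1, (((gate k B).val + t : ℤ) : ZMod (k + 1)) ∈ B →
        x ((gate k B).val + t + 1) <
          partialMul k B (gate k B).val x t ((gate k B).val + t) := by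
  set g : ℤ := ((gate k B).val : ℤ) with hgdef
  have hg' : (g : ZMod (k + 1)) ∉ B := by simpa [hgdef] using hg
  have hP := isShiftEquivariant_partialMul hk B g hx
  rw [mul_dElt_inv hk, (hP _).affLen_eq_invCount hk ((totalShift_partialMul hk B g hx _).trans h0),
    hx.affLen_eq_invCount hk h0, ← partialCard_period k B g]
  have hmono := invCount_partialMul_mono hk B g hx
  have hzero : invCount k (partialMul k B g x 0) + partialCard k B g 0 = invCount k x := by
    simp [partialMul, partialCard]
  constructor
  · intro h t ht hb
    have hall : ∀ s ≤ k + 1, invCount k (partialMul k B g x s) + partialCard k B g s =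
        invCount k x := fun s hs =>
      le_antisymm ((hmono hs).trans h.le) (hzero.symm.le.trans (hmono (Nat.zero_le s)))
    have h1 := hall t ht.le
    have h2 := hall (t + 1) ht
    rw [partialMul, partialCard_succ, if_pos hb, if_pos hb] at h2
    have h3 := (hP t).invCount_mul_sAff hk (g + t)
    rw [partialMul_apply_succ hk hg' x ht] at h3
    by_contra hlt
    rw [if_neg hlt] at h3
    omega
  · intro h
    have hall : ∀ s ≤ k + 1, invCount k (partialMul k B g x s) + partialCard k B g s =
        invCount k x := by
      intro s hs
      induction s with
      | zero => exact hzero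
      | succ s ih =>
        have ih := ih (by omega)
        rw [partialMul, partialCard_succ]
        split_ifs with hb
        · have h3 := (hP s).invCount_mul_sAff_of_gt hk (p := g + s)
            (by rw [partialMul_apply_succ hk hg' x hs]; exact h s hs hb)
          omega
        · exact ih
    exact hall (k + 1) le_rfl

theorem gate_notMem {k : ℕ} {B : Finset (ZMod (k + 1))} (hB : B ≠ Finset.univ) :
    gate k B ∉ B := by
  have h : ∃ g, g ∉ B := by
    by_contra! h
    exact hB (Finset.eq_univ_of_forall h)
  rw [gate, dif_pos h]
  exact h.choose_spec

open Classical in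
/-- The residues `a` such that `x (a + 1)` is not a left-to-right maximum of `x`. -/
noncomputable def nonRecordSet (k : ℕ) (x : Equiv.Perm ℤ) : Finset (ZMod (k + 1)) :=
  Finset.univ.filter fun a => ∃ m ≤ (a.val : ℤ), x ((a.val : ℤ) + 1) < x m

theorem IsShiftEquivariant.mem_nonRecordSet {k : ℕ} {x : Equiv.Perm ℤ}
    (hx : IsShiftEquivariant k x) (p : ℤ) :
    (p : ZMod (k + 1)) ∈ nonRecordSet k x ↔ ∃ m ≤ p, x (p + 1) < x m := by
  classical
  rw [nonRecordSet, Finset.mem_filter, and_iff_right (Finset.mem_univ _)]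
  refine iff_of_eq (eq_val_of_periodic (f := fun p : ℤ => ∃ m ≤ p, x (p + 1) < x m)
    (fun i => propext ?_) p)
  rw [add_right_comm, hx]
  constructor
  · rintro ⟨m, h1, h2⟩
    refine ⟨m - (k + 1), by linarith, ?_⟩
    have h := hx (m - (k + 1))
    rw [sub_add_cancel] at h
    linarith
  · rintro ⟨m, h1, h2⟩
    exact ⟨m + (k + 1), by linarith, by rw [hx]; linarith⟩

theorem IsShiftEquivariant.nonRecordSet_ne_univ {k : ℕ} {x : Equiv.Perm ℤ}
    (hx : IsShiftEquivariant k x) : nonRecordSet k x ≠ Finset.univ := by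
  intro h
  obtain ⟨C, hC⟩ := hx.exists_bound
  obtain ⟨z, ⟨m, hm, rfl⟩, hz⟩ := Int.exists_greatest_of_bdd
    (P := fun z => ∃ m ≤ (0 : ℤ), x m = z)
    ⟨C, by
      rintro z ⟨m, hm, rfl⟩
      have := (abs_le.1 (hC m)).2
      linarith⟩ ⟨x 0, 0, le_rfl, rfl⟩
  have hmem : ((m - 1 : ℤ) : ZMod (k + 1)) ∈ nonRecordSet k x := h ▸ Finset.mem_univ _
  obtain ⟨m', h1, h2⟩ := (hx.mem_nonRecordSet _).1 hmem
  rw [sub_add_cancel] at h2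
  exact (hz _ ⟨m', by omega, rfl⟩).not_gt h2

/-- there is a unique maximal proper subset `A ⊊ I` with
`x = y d_A` reduced; every other such subset is contained in it. -/
theorem exists_unique_max_right_set (k : ℕ) (hk : 1 ≤ k) (x : Equiv.Perm ℤ)
    (hx : IsAffinePerm k x) :
    ∃ A : Finset (ZMod (k + 1)), A ≠ Finset.univ ∧
      affLen k (x * (dElt k A)⁻¹) + A.card = affLen k x ∧
      ∀ B : Finset (ZMod (k + 1)), B ≠ Finset.univ →
        affLen k (x * (dElt k B)⁻¹) + B.card = affLen k x → B ⊆ A := by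
  have hS : IsShiftEquivariant k x := hx.1
  have h0 := hx.totalShift_eq_zero
  refine ⟨nonRecordSet k x, hS.nonRecordSet_ne_univ, ?_, ?_⟩
  · have hg := gate_notMem hS.nonRecordSet_ne_univ
    rw [affLen_mul_dElt_inv_iff hk hS h0 hg]
    set A := nonRecordSet k x
    set g : ℤ := ((gate k A).val : ℤ) with hgdef
    have hg' : (g : ZMod (k + 1)) ∉ A := by simpa [hgdef] using hg
    have hmax : ∀ t < k + 1, ∀ m ≤ g + t + 1,
        x m ≤ partialMul k A g x (t + 1) (g + t + 1) := by
      intro t ht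
      induction t with
      | zero =>
        intro m hm
        rw [partialMul_succ_apply hk hg' x ht, if_neg (by simpa using hg')]
        simp only [Nat.cast_zero, add_zero] at hm ⊢
        rcases hm.lt_or_eq with hm | rfl
        · by_contra hlt
          exact hg' ((hS.mem_nonRecordSet g).2 ⟨m, by omega, not_le.1 hlt⟩)
        · exact le_rfl
      | succ t ih =>
        intro m hm
        have ih := ih (by omega)
        rw [add_assoc g, ← Nat.cast_succ] at ih
        rw [partialMul_succ_apply hk hg' x ht]
        split_ifs with hb
        · rcases hm.lt_or_eq with hm | rfl
          · exact ih m (by omega)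
          · obtain ⟨m', h1, h2⟩ := (hS.mem_nonRecordSet _).1 hb
            exact h2.le.trans (ih m' h1)
        · rcases hm.lt_or_eq with hm | rfl
          · by_contra hlt
            exact hb ((hS.mem_nonRecordSet _).2 ⟨m, by omega, not_le.1 hlt⟩)
          · exact le_rfl
    rintro (_ | t) ht hb
    · exact absurd (by simpa using hb) hg'
    · obtain ⟨m, h1, h2⟩ := (hS.mem_nonRecordSet _).1 hb
      have h3 := hmax t (by omega) m (by push_cast at h1; omega)
      rw [add_assoc g, ← Nat.cast_succ] at h3
      exact h2.trans_le h3
  · intro B hB hlen b hb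
    have hg := gate_notMem hB
    rw [affLen_mul_dElt_inv_iff hk hS h0 hg] at hlen
    have hbt : (((gate k B).val + ((b - gate k B).val : ℕ) : ℤ) : ZMod (k + 1)) = b := by
      simp
    have ht := ZMod.val_lt (b - gate k B)
    obtain ⟨m, hm, h⟩ := exists_partialMul_apply_eq hk (g := (gate k B).val)
      (by simpa using hg) x ht.le
    have hlt := hlen _ ht (by rwa [hbt])
    rw [h] at hlt
    rw [← hbt]
    exact (hS.mem_nonRecordSet _).2 ⟨m, hm, hlt⟩
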